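/- Let N = 2^n with n ≥ 2, let F_N be the N×N DFT matrix, let R be the N×(N/2) reflection matrix and R̃ = R/√2 its normalisation, and let D be an invertible real diagonal (N/2)×(N/2) matrix. Define the solution matrix M = R̃ᵀ F_N† R̃ D^{−1} R̃ᵀ F_N R̃ ∈ ℂ^{(N/2)×(N/2)}. Then M M† = R̃ᵀ F_N† R̃ D^{−2} R̃ᵀ F_N R̃. In particular, if the input vector f has independent mean-zero entries with common variance σ², the covariance matrix of u = M f is σ² · R̃ᵀ F_N† R̃ D^{−2} R̃ᵀ F_N R̃. -/

import Mathlib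

open Matrix

/-- The `N`-th root of unity `ω_N = exp(2πi/N)`. -/
noncomputable def omegaN (N : ℕ) : ℂ := Complex.exp (2 * Real.pi * Complex.I / N)

/-- The `N × N` discrete Fourier transform matrix with entries `(F_N)_{jk} = ω_N^{jk} / √N`. -/
noncomputable def Fmat (N : ℕ) : Matrix (Fin N) (Fin N) ℂ :=
  fun j k => omegaN N ^ (j.val * k.val) / (Real.sqrt N : ℂ)

/-- The `N × (N/2)` reflection matrix for `N = 2^n`: `R_{k,k} = 1` and `R_{N−k,k} = −1` for
`1 ≤ k ≤ N/2 − 1`, all other entries zero. -/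
noncomputable def Rmat (n : ℕ) : Matrix (Fin (2 ^ n)) (Fin (2 ^ (n - 1))) ℂ :=
  fun j k =>
    if k.val ≠ 0 ∧ j.val = k.val then 1
    else if k.val ≠ 0 ∧ j.val = 2 ^ n - k.val then -1
    else 0

/-- The normalised reflection matrix `R̃ = R / √2`. -/
noncomputable def Rtil (n : ℕ) : Matrix (Fin (2 ^ n)) (Fin (2 ^ (n - 1))) ℂ :=
  (1 / (Real.sqrt 2 : ℂ)) • Rmat n

theorem omegaN_isPrimitiveRoot (N : ℕ) [NeZero N] : IsPrimitiveRoot (omegaN N) N :=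
  Complex.isPrimitiveRoot_exp N (NeZero.ne N)

theorem star_omegaN (N : ℕ) [NeZero N] : star (omegaN N) = (omegaN N)⁻¹ :=
  (Complex.inv_eq_conj ((omegaN_isPrimitiveRoot N).norm'_eq_one (NeZero.ne N))).symm

theorem omegaN_ne_zero (N : ℕ) [NeZero N] : omegaN N ≠ 0 := Complex.exp_ne_zero _

theorem Fmat_mul_conjTranspose (N : ℕ) [NeZero N] : Fmat N * (Fmat N)ᴴ = 1 := by
  have hN : (N : ℂ) ≠ 0 := Nat.cast_ne_zero.2 (NeZero.ne N)
  have hs : (Real.sqrt N : ℂ) * (Real.sqrt N : ℂ) = N := by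
    rw [← Complex.ofReal_mul, Real.mul_self_sqrt N.cast_nonneg, Complex.ofReal_natCast]
  have hω := omegaN_isPrimitiveRoot N
  have hω0 := omegaN_ne_zero N
  ext i j
  have key : (Fmat N * (Fmat N)ᴴ) i j =
      (∑ k ∈ Finset.range N, (omegaN N ^ i.val * (omegaN N ^ j.val)⁻¹) ^ k) / N := by
    rw [mul_apply, Finset.sum_div, ← Fin.sum_univ_eq_sum_range
      (fun k => (omegaN N ^ i.val * (omegaN N ^ j.val)⁻¹) ^ k / (N : ℂ))]
    refine Finset.sum_congr rfl fun k _ => ?_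
    rw [conjTranspose_apply, Fmat, Fmat, star_div₀, star_pow, star_omegaN,
      Complex.star_def, Complex.conj_ofReal, div_mul_div_comm, hs, mul_pow, inv_pow, inv_pow,
      pow_mul, pow_mul]
  rw [key]
  rcases eq_or_ne i j with rfl | hij
  · rw [mul_inv_cancel₀ (pow_ne_zero _ hω0)]
    simp [hN]
  · have hne : omegaN N ^ i.val * (omegaN N ^ j.val)⁻¹ ≠ 1 := by
      intro h
      refine hij (Fin.ext (hω.pow_inj i.isLt j.isLt ?_))
      rwa [← div_eq_mul_inv, div_eq_one_iff_eq (pow_ne_zero _ hω0)] at h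
    rw [geom_sum_eq hne, mul_pow, inv_pow, ← pow_mul, ← pow_mul, mul_comm i.val,
      mul_comm j.val, pow_mul, pow_mul, hω.pow_eq_one]
    simp [hij]

theorem Fmat_neg_left (N : ℕ) [NeZero N] (i j : Fin N) : Fmat N (-i) j = Fmat N i (-j) := by
  have hω := (omegaN_isPrimitiveRoot N).pow_eq_one
  have h0 := omegaN_ne_zero N
  have hpow (a : Fin N) : omegaN N ^ (-a).val = (omegaN N ^ a.val)⁻¹ := by
    rw [Fin.val_neg', ← pow_mod_orderOf, Nat.mod_mod_of_dvd _ (orderOf_dvd_of_pow_eq_one hω),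
      pow_mod_orderOf, pow_sub₀ _ h0 a.isLt.le, hω, one_mul]
  simp only [Fmat]
  rw [pow_mul, hpow, mul_comm, pow_mul, hpow, inv_pow, inv_pow, ← pow_mul, ← pow_mul, mul_comm]

theorem Fin.val_neg_eq_ite {N : ℕ} [NeZero N] (i : Fin N) :
    (-i).val = if i.val = 0 then 0 else N - i.val := by
  rw [Fin.val_neg']
  split_ifs with h
  · simp [h]
  · exact Nat.mod_eq_of_lt (by omega)

theorem Rmat_neg_left (n : ℕ) (hn : n ≠ 0) (i : Fin (2 ^ n)) (k : Fin (2 ^ (n - 1))) :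
    Rmat n (-i) k = -Rmat n i k := by
  have h2 : 2 ^ n = 2 * 2 ^ (n - 1) := by rw [← pow_succ', Nat.sub_add_cancel (by omega)]
  have hk := k.isLt
  have hi := i.isLt
  simp only [Rmat, Fin.val_neg_eq_ite]
  split_ifs <;> first | omega | simp

/-- `R Rᵀ = 1 - J` where `J` is the permutation matrix of index negation modulo `N`. -/
theorem Rmat_mul_transpose (n : ℕ) (hn : n ≠ 0) :
    Rmat n * (Rmat n)ᵀ = 1 - (1 : Matrix (Fin (2 ^ n)) (Fin (2 ^ n)) ℂ).submatrix Neg.neg id := by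
  have h2 : 2 ^ n = 2 * 2 ^ (n - 1) := by rw [← pow_succ', Nat.sub_add_cancel (by omega)]
  ext i j
  have hi := i.isLt
  have hj := j.isLt
  rw [mul_apply]
  simp only [transpose_apply, Matrix.sub_apply, submatrix_apply, one_apply, Fin.ext_iff,
    Fin.val_neg_eq_ite, id]
  by_cases h0 : i.val = 0 ∨ i.val = 2 ^ (n - 1)
  · rw [Finset.sum_eq_zero]
    · split_ifs <;> first | omega | simp
    · intro k _
      have hk := k.isLt
      simp only [Rmat]
      split_ifs <;> first | omega | simp
  · have hm : (if i.val < 2 ^ (n - 1) then i.val else 2 ^ n - i.val) < 2 ^ (n - 1) := by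
      split_ifs <;> omega
    rw [Finset.sum_eq_single ⟨_, hm⟩]
    · simp only [Rmat]
      split_ifs <;> first | omega | simp
    · intro k _ hk
      have hk' := k.isLt
      rw [Ne, Fin.ext_iff] at hk
      simp only at hk
      simp only [Rmat]
      split_ifs at hk ⊢ <;> first | omega | simp
    · simp

/-- `R̃ R̃ᵀ` fixes every matrix whose columns are antisymmetric. -/
theorem Rtil_mul_transpose_mul (n : ℕ) (hn : n ≠ 0) {m : Type*} (X : Matrix (Fin (2 ^ n)) m ℂ)
    (hX : ∀ i k, X (-i) k = -X i k) : Rtil n * (Rtil n)ᵀ * X = X := by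
  have hs : (1 / (Real.sqrt 2 : ℂ)) * (1 / (Real.sqrt 2 : ℂ)) = 1 / 2 := by
    rw [div_mul_div_comm, ← Complex.ofReal_mul, Real.mul_self_sqrt zero_le_two]
    simp
  have hJ : (1 : Matrix (Fin (2 ^ n)) (Fin (2 ^ n)) ℂ).submatrix Neg.neg id * X = -X := by
    ext i k
    simp [mul_apply, one_apply, hX]
  rw [Rtil, transpose_smul, Matrix.smul_mul, Matrix.mul_smul, smul_smul, hs,
    Rmat_mul_transpose n hn, Matrix.smul_mul,
    Matrix.sub_mul, hJ, Matrix.one_mul]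
  ext i k
  simp only [Matrix.smul_apply, Matrix.sub_apply, Matrix.neg_apply, smul_eq_mul]
  ring

theorem Rtil_neg_left (n : ℕ) (hn : n ≠ 0) (i : Fin (2 ^ n)) (k : Fin (2 ^ (n - 1))) :
    Rtil n (-i) k = -Rtil n i k := by
  simp [Rtil, Rmat_neg_left n hn]

theorem conjTranspose_Rtil (n : ℕ) : (Rtil n)ᴴ = (Rtil n)ᵀ := by
  ext k i
  simp only [conjTranspose_apply, transpose_apply, Rtil, Rmat, Matrix.smul_apply, smul_eq_mul]
  split_ifs <;> simp

theorem isDiag_Rtil_transpose_mul (n : ℕ) (hn : n ≠ 0) : ((Rtil n)ᵀ * Rtil n).IsDiag := by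
  have h2 : 2 ^ n = 2 * 2 ^ (n - 1) := by rw [← pow_succ', Nat.sub_add_cancel (by omega)]
  intro k l hkl
  rw [mul_apply]
  refine Finset.sum_eq_zero fun i _ => ?_
  have hk := k.isLt
  have hl := l.isLt
  rw [Ne, Fin.ext_iff] at hkl
  simp only [transpose_apply, Rtil, Rmat, Matrix.smul_apply]
  split_ifs <;> first | omega | simp

theorem conjTranspose_Fmat_mul_Rtil_neg_left (n : ℕ) (hn : n ≠ 0) (i : Fin (2 ^ n))
    (k : Fin (2 ^ (n - 1))) :
    ((Fmat (2 ^ n))ᴴ * Rtil n) (-i) k = -((Fmat (2 ^ n))ᴴ * Rtil n) i k := by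
  rw [mul_apply, mul_apply, ← Finset.sum_neg_distrib]
  refine Fintype.sum_equiv (Equiv.neg _) _ _ fun j => ?_
  rw [Equiv.neg_apply, Rtil_neg_left n hn, conjTranspose_apply, conjTranspose_apply,
    Fmat_neg_left]
  ring

/-- Let `N = 2^n`, `n ≥ 2`, let `D` be an invertible real diagonal `(N/2) × (N/2)` matrix,
and let `M = R̃ᵀ F_N† R̃ D⁻¹ R̃ᵀ F_N R̃` be the discrete spectral solution operator.  Then
`M M† = R̃ᵀ F_N† R̃ D⁻² R̃ᵀ F_N R̃`, the covariance matrix (up to the variance `σ²` of the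
white-noise input) of the discrete Gaussian random field `u = M f`. -/
theorem solution_operator_covariance (n : ℕ) (hn : 2 ≤ n)
    (d : Fin (2 ^ (n - 1)) → ℝ) (hd : ∀ k, d k ≠ 0) :
    ((Rtil n)ᵀ * (Fmat (2 ^ n))ᴴ * Rtil n * (Matrix.diagonal (fun k => (d k : ℂ)))⁻¹ *
        (Rtil n)ᵀ * Fmat (2 ^ n) * Rtil n) *
      ((Rtil n)ᵀ * (Fmat (2 ^ n))ᴴ * Rtil n * (Matrix.diagonal (fun k => (d k : ℂ)))⁻¹ *
        (Rtil n)ᵀ * Fmat (2 ^ n) * Rtil n)ᴴ =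
    (Rtil n)ᵀ * (Fmat (2 ^ n))ᴴ * Rtil n * ((Matrix.diagonal (fun k => (d k : ℂ))) ^ 2)⁻¹ *
      (Rtil n)ᵀ * Fmat (2 ^ n) * Rtil n := by
  have hn0 : n ≠ 0 := by omega
  set R := Rtil n with hR
  set F := Fmat (2 ^ n) with hF
  set D := Matrix.diagonal (fun k => (d k : ℂ)) with hD
  have hDH : (D⁻¹)ᴴ = D⁻¹ := by
    rw [conjTranspose_nonsing_inv, hD, diagonal_conjTranspose]
    congr 2
    ext k
    simp
  have hQF : R * (Rᵀ * (Fᴴ * R)) = Fᴴ * R := by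
    rw [← Matrix.mul_assoc]
    exact Rtil_mul_transpose_mul n hn0 _ (conjTranspose_Fmat_mul_Rtil_neg_left n hn0)
  have hRP : R * (Rᵀ * R) = R := by
    rw [← Matrix.mul_assoc]
    exact Rtil_mul_transpose_mul n hn0 _ (Rtil_neg_left n hn0)
  have hFF : F * (Fᴴ * R) = R := by
    rw [← Matrix.mul_assoc, hF, Fmat_mul_conjTranspose, Matrix.one_mul]
  have hcomm : D⁻¹ * (Rᵀ * R) = Rᵀ * R * D⁻¹ := by
    rw [← (isDiag_Rtil_transpose_mul n hn0).diagonal_diag, hD, inv_diagonal, diagonal_mul_diagonal,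
      diagonal_mul_diagonal]
    simp only [mul_comm]
  have hRt : Rᴴ = Rᵀ := conjTranspose_Rtil n
  have hRt' : (Rᵀ)ᴴ = R := by rw [← hRt, conjTranspose_conjTranspose]
  have hstar : (Rᵀ * Fᴴ * R * D⁻¹ * Rᵀ * F * R)ᴴ = Rᵀ * (Fᴴ * R) * (D⁻¹ * (Rᵀ * F * R)) := by
    simp only [conjTranspose_mul, conjTranspose_conjTranspose, hRt, hRt', hDH, Matrix.mul_assoc]
  calc _ = Rᵀ * Fᴴ * R * D⁻¹ * (Rᵀ * (F * (R * (Rᵀ * (Fᴴ * R))))) * (D⁻¹ * (Rᵀ * F * R)) := by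
        rw [hstar]
        simp only [Matrix.mul_assoc]
    _ = Rᵀ * Fᴴ * R * (D⁻¹ * (Rᵀ * R)) * (D⁻¹ * (Rᵀ * F * R)) := by
        rw [hQF, hFF]
        simp only [Matrix.mul_assoc]
    _ = Rᵀ * Fᴴ * (R * (Rᵀ * R)) * D⁻¹ * (D⁻¹ * (Rᵀ * F * R)) := by
        rw [hcomm]
        simp only [Matrix.mul_assoc]
    _ = _ := by
        rw [hRP, pow_two, Matrix.mul_inv_rev]
        simp only [Matrix.mul_assoc]
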